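/- Let M ∈ MS_n, and define a_1 = ur_1(M) + ur_1*(M) and M^(1) = f_1^{a_1}(M), and inductively a_{k+1} = ur_{k+1}(M^(k)) + ur*_{k+1}(M^(k)), M^(k+1) = f_{k+1}^{a_{k+1}}(M^(k)). Then for all 2 ≤ i ≤ k ≤ n, the multiplicity of [i-1, k-1] in M^(k) equals the multiplicity of [i,k] in M. -/

import Mathlib

/-- A segment `[a,b]` is a pair of integers. -/
abbrev Seg : Type := ℕ × ℕ

/-- A multisegment is a finite multiset of segments. -/
abbrev MS : Type := Multiset Seg

/-- `M ∈ MS_n`: all segments `[a,b]` satisfy `1 ≤ a ≤ b ≤ n`. -/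
def IsMS (n : ℕ) (M : MS) : Prop := ∀ s ∈ M, 1 ≤ s.1 ∧ s.1 ≤ s.2 ∧ s.2 ≤ n

/-- A bracket: `op` = "(", `cl` = ")". -/
inductive Br | op | cl
deriving DecidableEq

/-- One step of the left-to-right bracket cancellation procedure.  The state
`(cls, ops)` records the tags of the currently uncanceled ")" (in order) and the
currently uncanceled "(" (in order).  A new "(" is appended to `ops`; a new ")"
cancels the last uncanceled "(" if there is one, and otherwise is appended to `cls`. -/
def step {τ : Type} : (List τ × List τ) → (Br × τ) → (List τ × List τ)
  | (cls, ops), (Br.op, s) => (cls, ops ++ [s])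
  | (cls, ops), (Br.cl, s) => if ops.isEmpty then (cls ++ [s], ops) else (cls, ops.dropLast)

/-- Process a tagged bracket string; the result `(cls, ops)` lists the tags of the
uncanceled ")" and the uncanceled "(" (left to right).  The reduced (uncanceled)
string is `")"^cls.length ++ "("^ops.length`. -/
def scan {τ : Type} (l : List (Br × τ)) : List τ × List τ := l.foldl step ([], [])

/-- Number of uncanceled ")" in a tagged bracket string. -/
def urStr {τ : Type} (l : List (Br × τ)) : ℕ := (scan l).1.length

/-- Number of uncanceled "(" in a tagged bracket string. -/
def epsStr {τ : Type} (l : List (Br × τ)) : ℕ := (scan l).2.length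

/-- Tag of the rightmost uncanceled ")", if any. -/
def lastCl {τ : Type} (l : List (Br × τ)) : Option τ := (scan l).1.getLast?

/-- Tag of the leftmost uncanceled "(", if any. -/
def headOp {τ : Type} (l : List (Br × τ)) : Option τ := (scan l).2.head?

/-- The string `S_i(M)`: segments are ordered by increasing height, then by
decreasing lower endpoint; each `[h,i]` contributes "(" and each `[h,i-1]`
contributes ")".  In the block of segments of height `t` the "(" over the
`[i-t+1, i]` segments come immediately before the ")" over the `[i-t, i-1]`
segments, and blocks appear for `t = 1, 2, …`. -/
def Si (M : MS) (i : ℕ) : List (Br × Seg) :=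
  (List.range i).flatMap fun t0 =>
    let t := t0 + 1
    List.replicate (M.count (i - t + 1, i)) (Br.op, ((i - t + 1 : ℕ), i)) ++
    List.replicate (M.count (i - t, i - 1)) (Br.cl, ((i - t : ℕ), i - 1))

/-- The string `S_i^*(M)`: segments ordered by increasing height, then by
increasing lower endpoint; each `[i,j]` contributes "(" and each `[i+1,j]`
contributes ")".  In the block of height `t` the "(" below the `[i, i+t-1]`
segments come immediately before the ")" below the `[i+1, i+t]` segments. -/
def SiStar (n : ℕ) (M : MS) (i : ℕ) : List (Br × Seg) :=
  (List.range n).flatMap fun t0 =>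
    let t := t0 + 1
    List.replicate (M.count (i, i + t - 1)) (Br.op, (i, i + t - 1)) ++
    List.replicate (M.count (i + 1, i + t)) (Br.cl, (i + 1, i + t))

/-- The crystal operator `f_i` on multisegments: it changes the segment `[h,i-1]`
under the rightmost uncanceled ")" of `S_i(M)` into `[h,i]`, or adds a new
segment `[i,i]` if there is no uncanceled ")". -/
def fM (i : ℕ) (M : MS) : MS :=
  match lastCl (Si M i) with
  | some s => M.erase s + {(s.1, i)}
  | none => M + {(i, i)}

/-- The crystal operator `e_i` on multisegments: it changes the segment `[h,i]`
under the leftmost uncanceled "(" of `S_i(M)` into `[h,i-1]` (deleting it when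
`h = i`), or returns `none` (i.e. `0`) if there is no uncanceled "(". -/
def eM (i : ℕ) (M : MS) : Option MS :=
  match headOp (Si M i) with
  | some s => some (if s.1 = i then M.erase s else M.erase s + {(s.1, i - 1)})
  | none => none

/-- The operator `f_i^*`: it changes the segment `[i+1,j]` under the rightmost
uncanceled ")" of `S_i^*(M)` into `[i,j]`, or adds `[i,i]` if there is none. -/
def fMStar (n i : ℕ) (M : MS) : MS :=
  match lastCl (SiStar n M i) with
  | some s => M.erase s + {(i, s.2)}
  | none => M + {(i, i)}

/-- The operator `e_i^*`: it changes the segment `[i,j]` under the leftmost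
uncanceled "(" of `S_i^*(M)` into `[i+1,j]` (deleting it when `j = i`), or
returns `none` if there is no uncanceled "(". -/
def eMStar (n i : ℕ) (M : MS) : Option MS :=
  match headOp (SiStar n M i) with
  | some s => some (if s.2 = i then M.erase s else M.erase s + {(i + 1, s.2)})
  | none => none

/-- The number of boxes labeled `j` in `M`: each segment `[a,b]` contains one
box labeled `j` for each `a ≤ j ≤ b`. -/
def boxes (M : MS) (j : ℕ) : ℕ :=
  (M.filter (fun s => s.1 ≤ j ∧ j ≤ s.2)).card

/-- The pairing `⟨wt(M), α_i^∨⟩ = #(boxes i-1) + #(boxes i+1) - 2 #(boxes i)`. -/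
def wtPair (M : MS) (i : ℕ) : ℤ :=
  (boxes M (i - 1) : ℤ) + (boxes M (i + 1) : ℤ) - 2 * (boxes M i : ℤ)


/-- The sequence `M = M^(0), M^(1), …`, where `M^(k+1)` is obtained from `M^(k)`
by applying `f_{k+1}` exactly `a_{k+1} = ur_{k+1}(M^(k)) + ur_{k+1}^*(M^(k))` times. -/
def Mseq (n : ℕ) (M : MS) : ℕ → MS
  | 0 => M
  | k + 1 =>
      (fM (k + 1))^[urStr (Si (Mseq n M k) (k + 1)) + urStr (SiStar n (Mseq n M k) (k + 1))]
        (Mseq n M k)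

/-- Bracket string made of the blocks `"("^(o t) ")"^(c t)` for `t < m`, tagged by `a t`, `b t`. -/
def bracketBlocks {τ : Type} (o c : ℕ → ℕ) (a b : ℕ → τ) (m : ℕ) : List (Br × τ) :=
  (List.range m).flatMap fun t =>
    List.replicate (o t) (Br.op, a t) ++ List.replicate (c t) (Br.cl, b t)

/-- Number of uncanceled "(" after the first `t` blocks. -/
def excess (o c : ℕ → ℕ) : ℕ → ℕ
  | 0 => 0
  | t + 1 => excess o c t + o t - c t

/-- Number of uncanceled ")" in block `t`. -/
def surplus (o c : ℕ → ℕ) (t : ℕ) : ℕ := c t - (excess o c t + o t)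

theorem foldl_step_replicate_op {τ : Type} (m : ℕ) (a : τ) (p q : List τ) :
    (List.replicate m (Br.op, a)).foldl step (p, q) = (p, q ++ List.replicate m a) := by
  induction m generalizing q with
  | zero => simp
  | succ m ih => simp [List.replicate_succ, step, ih]

theorem foldl_step_replicate_cl {τ : Type} (m : ℕ) (b : τ) (p q : List τ) :
    ((List.replicate m (Br.cl, b)).foldl step (p, q)).1 = p ++ List.replicate (m - q.length) b ∧
    ((List.replicate m (Br.cl, b)).foldl step (p, q)).2.length = q.length - m := by
  induction m generalizing p q with
  | zero => simp
  | succ m ih =>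
    rcases q with _ | ⟨x, q⟩
    · have := ih (p ++ [b]) []
      simpa [List.replicate_succ, step] using this
    · have := ih p (x :: q).dropLast
      simpa [List.replicate_succ, step] using this

theorem scan_bracketBlocks {τ : Type} (o c : ℕ → ℕ) (a b : ℕ → τ) (m : ℕ) :
    (scan (bracketBlocks o c a b m)).1 =
      (List.range m).flatMap (fun t => List.replicate (surplus o c t) (b t)) ∧
    (scan (bracketBlocks o c a b m)).2.length = excess o c m := by
  induction m with
  | zero => simp [bracketBlocks, scan, excess]
  | succ m ih =>
    obtain ⟨ih1, ih2⟩ := ih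
    have hs : scan (bracketBlocks o c a b (m + 1)) =
        (List.replicate (c m) (Br.cl, b m)).foldl step
          ((scan (bracketBlocks o c a b m)).1,
            (scan (bracketBlocks o c a b m)).2 ++ List.replicate (o m) (a m)) := by
      rw [← foldl_step_replicate_op]
      simp [bracketBlocks, scan, List.range_succ]
    obtain ⟨h1, h2⟩ := foldl_step_replicate_cl (c m) (b m) (scan (bracketBlocks o c a b m)).1
      ((scan (bracketBlocks o c a b m)).2 ++ List.replicate (o m) (a m))
    rw [hs, h1, h2, ih1]
    simp [List.range_succ, ih2, surplus, excess]

theorem urStr_bracketBlocks {τ : Type} (o c : ℕ → ℕ) (a b : ℕ → τ) (m : ℕ) :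
    urStr (bracketBlocks o c a b m) = ∑ t ∈ Finset.range m, surplus o c t := by
  rw [urStr, (scan_bracketBlocks o c a b m).1]
  induction m with
  | zero => simp
  | succ m ih => simp [List.range_succ, Finset.sum_range_succ, ← ih]

theorem lastCl_bracketBlocks_of_eq_zero {τ : Type} (o c : ℕ → ℕ) (a b : ℕ → τ) (m : ℕ)
    (h : ∀ t < m, surplus o c t = 0) : lastCl (bracketBlocks o c a b m) = none := by
  rw [lastCl, (scan_bracketBlocks o c a b m).1, List.getLast?_eq_none_iff,
    List.flatMap_eq_nil_iff]
  intro t ht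
  simp [h t (List.mem_range.1 ht)]

theorem lastCl_bracketBlocks_of_pos {τ : Type} (o c : ℕ → ℕ) (a b : ℕ → τ) {m T : ℕ} (hT : T < m)
    (hpos : 0 < surplus o c T) (h : ∀ t, T < t → t < m → surplus o c t = 0) :
    lastCl (bracketBlocks o c a b m) = some (b T) := by
  rw [lastCl, (scan_bracketBlocks o c a b m).1]
  induction m with
  | zero => omega
  | succ m ih =>
    rw [List.range_succ, List.flatMap_append]
    rcases Nat.lt_succ_iff_lt_or_eq.1 hT with hlt | rfl
    · simpa [h m hlt (Nat.lt_succ_self m)] using ih hlt fun t h1 h2 => h t h1 (by omega)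
    · simp [List.getLast?_append, List.getLast?_replicate, hpos.ne']

theorem exists_last_surplus_pos (o c : ℕ → ℕ) {m : ℕ}
    (h : ∑ t ∈ Finset.range m, surplus o c t ≠ 0) :
    ∃ T < m, 0 < surplus o c T ∧ ∀ t, T < t → t < m → surplus o c t = 0 := by
  induction m with
  | zero => simp at h
  | succ m ih =>
    by_cases hm : surplus o c m = 0
    · rw [Finset.sum_range_succ, hm, add_zero] at h
      obtain ⟨T, hT, hpos, hz⟩ := ih h
      refine ⟨T, by omega, hpos, fun t h1 h2 => ?_⟩
      rcases Nat.lt_succ_iff_lt_or_eq.1 h2 with h3 | rfl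
      · exact hz t h1 h3
      · exact hm
    · exact ⟨m, by omega, by omega, fun t h1 h2 => by omega⟩

/-- Turning the last uncanceled ")" into a "(" only lowers the surplus of its block. -/
theorem surplus_move {o c o' c' : ℕ → ℕ} {m T : ℕ}
    (hpos : 0 < surplus o c T) (h : ∀ t, T < t → t < m → surplus o c t = 0)
    (hc : ∀ t < m, c' t = c t - if t = T then 1 else 0)
    (ho : ∀ t < m, o' t = o t + if t = T + 1 then 1 else 0) :
    ∀ t < m, surplus o' c' t = surplus o c t - if t = T then 1 else 0 := by
  have key : ∀ t ≤ m, excess o' c' t = excess o c t + if T + 1 < t then 1 else 0 := by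
    intro t
    induction t with
    | zero => simp [excess]
    | succ t ih =>
      intro ht
      have ih := ih (by omega)
      have hz := h t
      have hct := hc t (by omega)
      have hot := ho t (by omega)
      simp only [excess, surplus] at *
      rcases eq_or_ne t T with rfl | hne
      · simp at *
        omega
      · split_ifs at * <;> omega
  intro t ht
  have hk := key t ht.le
  have hz := h t
  have hct := hc t ht
  have hot := ho t ht
  simp only [surplus] at *
  split_ifs at * <;> omega

theorem sum_add_excess (o c : ℕ → ℕ) (m : ℕ) :
    ∑ t ∈ Finset.range m, c t + excess o c m =
      ∑ t ∈ Finset.range m, o t + ∑ t ∈ Finset.range m, surplus o c t := by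
  induction m with
  | zero => simp [excess]
  | succ m ih =>
    simp only [Finset.sum_range_succ, excess, surplus] at *
    omega

theorem excess_eq_zero {o c : ℕ → ℕ} {m : ℕ} (h : ∀ t < m, o t ≤ c t) : excess o c m = 0 := by
  induction m with
  | zero => rfl
  | succ m ih =>
    have := h m (by omega)
    rw [excess, ih fun t ht => h t (by omega)]
    omega

/-- Multiplicities of the segments `[k-t, k]`. -/
def opCount (N : MS) (k t : ℕ) : ℕ := N.count (k - t, k)

/-- Multiplicities of the segments `[k-t-1, k-1]`. -/
def clCount (N : MS) (k t : ℕ) : ℕ := N.count (k - (t + 1), k - 1)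

/-- Number of uncanceled ")" over the segments `[k-t-1, k-1]` in `S_k(N)`. -/
def siSurplus (N : MS) (k t : ℕ) : ℕ := surplus (opCount N k) (clCount N k) t

theorem Si_eq_bracketBlocks (N : MS) (k : ℕ) :
    Si N k = bracketBlocks (opCount N k) (clCount N k) (fun t => (k - t, k))
      (fun t => (k - (t + 1), k - 1)) k := by
  unfold Si bracketBlocks
  refine List.flatMap_congr fun t ht => ?_
  have : k - (t + 1) + 1 = k - t := by
    have := List.mem_range.1 ht
    omega
  simp [opCount, clCount, this]

theorem SiStar_eq_bracketBlocks (n : ℕ) (N : MS) (k : ℕ) :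
    SiStar n N k = bracketBlocks (fun t => N.count (k, k + t)) (fun t => N.count (k + 1, k + t + 1))
      (fun t => (k, k + t)) (fun t => (k + 1, k + t + 1)) n := rfl

theorem urStr_Si (N : MS) (k : ℕ) :
    urStr (Si N k) = ∑ t ∈ Finset.range k, siSurplus N k t := by
  rw [Si_eq_bracketBlocks, urStr_bracketBlocks]
  rfl

theorem sum_count_le_add_urStr_SiStar (n : ℕ) (N : MS) (k : ℕ) {m : ℕ} (hm : m ≤ n) :
    ∑ t ∈ Finset.range m, N.count (k + 1, k + t + 1) ≤
      ∑ t ∈ Finset.range m, N.count (k, k + t) + urStr (SiStar n N k) := by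
  rw [SiStar_eq_bracketBlocks, urStr_bracketBlocks]
  have h1 := sum_add_excess (fun t => N.count (k, k + t)) (fun t => N.count (k + 1, k + t + 1)) m
  have h2 : ∑ t ∈ Finset.range m, surplus (fun t => N.count (k, k + t))
      (fun t => N.count (k + 1, k + t + 1)) t ≤ ∑ t ∈ Finset.range n,
      surplus (fun t => N.count (k, k + t)) (fun t => N.count (k + 1, k + t + 1)) t :=
    Finset.sum_le_sum_of_subset (Finset.range_subset_range.2 hm)
  omega

theorem fM_of_urStr_eq_zero {N : MS} {k : ℕ} (h : urStr (Si N k) = 0) : fM k N = N + {(k, k)} := by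
  rw [urStr_Si, Finset.sum_eq_zero_iff] at h
  have : lastCl (Si N k) = none := by
    rw [Si_eq_bracketBlocks]
    exact lastCl_bracketBlocks_of_eq_zero _ _ _ _ _ fun t ht => h t (Finset.mem_range.2 ht)
  rw [fM, this]

theorem urStr_Si_add_singleton {N : MS} {k : ℕ} (hk : 1 ≤ k) (h : urStr (Si N k) = 0) :
    urStr (Si (N + {(k, k)}) k) = 0 := by
  rw [urStr_Si, Finset.sum_eq_zero_iff] at h ⊢
  have hc : ∀ t, clCount (N + {(k, k)}) k t = clCount N k t := fun t => by
    have : k - 1 ≠ k := by omega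
    simp [clCount, this]
  have ho : ∀ t, opCount N k t ≤ opCount (N + {(k, k)}) k t := fun t => by simp [opCount]
  have he : ∀ t, excess (opCount N k) (clCount N k) t ≤
      excess (opCount (N + {(k, k)}) k) (clCount (N + {(k, k)}) k) t := fun t => by
    induction t with
    | zero => simp [excess]
    | succ t ih =>
      have := hc t
      have := ho t
      simp only [excess]
      omega
  intro t ht
  have := h t ht
  have := hc t
  have := ho t
  have := he t
  simp only [siSurplus, surplus] at *
  omega

theorem iterate_fM_of_urStr_eq_zero {N : MS} {k : ℕ} (hk : 1 ≤ k) (h : urStr (Si N k) = 0)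
    (r : ℕ) : (fM k)^[r] N = N + Multiset.replicate r (k, k) := by
  induction r generalizing N with
  | zero => simp
  | succ r ih =>
    rw [Function.iterate_succ_apply, fM_of_urStr_eq_zero h, ih (urStr_Si_add_singleton hk h),
      Multiset.replicate_succ, ← Multiset.singleton_add, add_assoc]

/-- `f_k` when `S_k(N)` has an uncanceled ")". -/
theorem exists_fM_move {N : MS} {k : ℕ} (h : urStr (Si N k) ≠ 0) :
    ∃ T < k, 0 < siSurplus N k T ∧
      (∀ a b, (fM k N).count (a, b) =
        N.count (a, b) - (if (a, b) = (k - (T + 1), k - 1) then 1 else 0) +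
          if (a, b) = (k - (T + 1), k) then 1 else 0) ∧
      ∀ t < k, siSurplus (fM k N) k t = siSurplus N k t - if t = T then 1 else 0 := by
  rw [urStr_Si] at h
  obtain ⟨T, hT, hpos, hz⟩ := exists_last_surplus_pos _ _ h
  have hcount : ∀ a b, (fM k N).count (a, b) =
      N.count (a, b) - (if (a, b) = (k - (T + 1), k - 1) then 1 else 0) +
        if (a, b) = (k - (T + 1), k) then 1 else 0 := by
    intro a b
    rw [fM, Si_eq_bracketBlocks, lastCl_bracketBlocks_of_pos _ _ _ _ hT hpos hz]
    simp only [Multiset.count_add, Multiset.count_singleton]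
    congr 1
    split_ifs with heq
    · rw [heq, Multiset.count_erase_self]
    · rw [Multiset.count_erase_of_ne heq, Nat.sub_zero]
  refine ⟨T, hT, hpos, hcount, surplus_move hpos hz (fun t ht => ?_) fun t ht => ?_⟩
  · have h1 : k - 1 ≠ k := by omega
    have h2 : k - (t + 1) = k - (T + 1) ↔ t = T := by omega
    simp [clCount, hcount, h1, h2]
  · have h1 : k ≠ k - 1 := by omega
    have h2 : k - t = k - (T + 1) ↔ t = T + 1 := by omega
    simp [opCount, hcount, h1, h2]

theorem iterate_fM_urStr {N : MS} {k : ℕ} {j : ℕ} (h : urStr (Si N k) = j) :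
    urStr (Si ((fM k)^[j] N) k) = 0 ∧
    (∀ t < k, ((fM k)^[j] N).count (k - (t + 1), k - 1) + siSurplus N k t =
      N.count (k - (t + 1), k - 1)) ∧
    (∀ t < k, ((fM k)^[j] N).count (k - (t + 1), k) =
      N.count (k - (t + 1), k) + siSurplus N k t) ∧
    ((fM k)^[j] N).count (k, k) = N.count (k, k) ∧
    ∀ a b, k < b → ((fM k)^[j] N).count (a, b) = N.count (a, b) := by
  induction j generalizing N with
  | zero =>
    have hz := h
    rw [urStr_Si, Finset.sum_eq_zero_iff] at hz
    have hz : ∀ t < k, siSurplus N k t = 0 := fun t ht => hz t (Finset.mem_range.2 ht)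
    refine ⟨h, fun t ht => ?_, fun t ht => ?_, rfl, fun _ _ _ => rfl⟩ <;> simp [hz t ht]
  | succ j ih =>
    obtain ⟨T, hT, hpos, hcount, hsur⟩ := exists_fM_move (N := N) (k := k) (by omega)
    have hj : urStr (Si (fM k N) k) = j := by
      rw [urStr_Si] at h ⊢
      have hmem := Finset.mem_range.2 hT
      rw [← Finset.add_sum_erase _ _ hmem] at h ⊢
      have : ∑ t ∈ (Finset.range k).erase T, siSurplus (fM k N) k t =
          ∑ t ∈ (Finset.range k).erase T, siSurplus N k t := by
        refine Finset.sum_congr rfl fun t ht => ?_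
        obtain ⟨hne, htk⟩ := Finset.mem_erase.1 ht
        rw [hsur t (Finset.mem_range.1 htk), if_neg hne, Nat.sub_zero]
      rw [this, hsur T hT, if_pos rfl]
      omega
    obtain ⟨i0, i1, i2, i3, i4⟩ := ih hj
    rw [Function.iterate_succ_apply]
    have hk1 : k - 1 ≠ k := by omega
    have hk2 : k ≠ k - 1 := by omega
    refine ⟨i0, fun t ht => ?_, fun t ht => ?_, ?_, fun a b hb => ?_⟩
    · have h1 := i1 t ht
      have h2 : k - (t + 1) = k - (T + 1) ↔ t = T := by omega
      have hle : siSurplus N k T ≤ N.count (k - (T + 1), k - 1) := Nat.sub_le _ _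
      rw [hsur t ht, hcount] at h1
      simp only [Prod.mk.injEq, h2, hk1, and_true, and_false, if_false] at h1
      by_cases htT : t = T
      · subst htT
        simp only [if_true] at h1
        omega
      · simpa [htT] using h1
    · have h1 := i2 t ht
      have h2 : k - (t + 1) = k - (T + 1) ↔ t = T := by omega
      rw [hsur t ht, hcount] at h1
      simp only [Prod.mk.injEq, h2, hk2, and_true, and_false, if_false] at h1
      by_cases htT : t = T
      · subst htT
        simp only [if_true] at h1
        omega
      · simpa [htT] using h1
    · rw [i3, hcount]
      have : k ≠ k - (T + 1) := by omega
      simp [this]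
    · rw [i4 a b hb, hcount]
      have h1 : b ≠ k - 1 := by omega
      simp [h1, hb.ne']

theorem count_Mseq_of_lt (n : ℕ) (M : MS) {k b : ℕ} (a : ℕ) (hb : k < b) :
    (Mseq n M k).count (a, b) = M.count (a, b) := by
  induction k with
  | zero => rfl
  | succ k ih =>
    obtain ⟨h0, -, -, -, h4⟩ := iterate_fM_urStr (N := Mseq n M k) (k := k + 1) rfl
    rw [Mseq, add_comm (urStr (Si _ _)), Function.iterate_add_apply,
      iterate_fM_of_urStr_eq_zero (by omega) h0, Multiset.count_add, h4 a b hb, ih (by omega),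
      Multiset.count_replicate, if_neg (by simp [hb.ne]), add_zero]

theorem count_Mseq_succ_left (n : ℕ) (M : MS) (k : ℕ) {t : ℕ} (ht : t < k + 1) :
    (Mseq n M (k + 1)).count (k + 1 - (t + 1), k) + siSurplus (Mseq n M k) (k + 1) t =
      (Mseq n M k).count (k + 1 - (t + 1), k) := by
  obtain ⟨h0, h1, -, -, -⟩ := iterate_fM_urStr (N := Mseq n M k) (k := k + 1) rfl
  rw [Mseq, add_comm (urStr (Si _ _)), Function.iterate_add_apply,
    iterate_fM_of_urStr_eq_zero (by omega) h0, Multiset.count_add,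
    Multiset.count_replicate, if_neg (by simp), add_zero]
  exact h1 t ht

theorem count_Mseq_succ_right (n : ℕ) (M : MS) (k : ℕ) {t : ℕ} (ht : t < k + 1) :
    (Mseq n M (k + 1)).count (k + 1 - (t + 1), k + 1) =
      M.count (k + 1 - (t + 1), k + 1) + siSurplus (Mseq n M k) (k + 1) t := by
  obtain ⟨h0, -, h2, -, -⟩ := iterate_fM_urStr (N := Mseq n M k) (k := k + 1) rfl
  have hne : (k + 1, k + 1) ≠ (k + 1 - (t + 1), k + 1) := by
    simp only [ne_eq, Prod.mk.injEq]
    omega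
  rw [Mseq, add_comm (urStr (Si _ _)), Function.iterate_add_apply,
    iterate_fM_of_urStr_eq_zero (by omega) h0, Multiset.count_add,
    Multiset.count_replicate, if_neg hne, add_zero, h2 t ht, count_Mseq_of_lt n M _ (by omega)]

theorem count_Mseq_succ_diag (n : ℕ) (M : MS) (k : ℕ) :
    (Mseq n M (k + 1)).count (k + 1, k + 1) =
      M.count (k + 1, k + 1) + urStr (SiStar n (Mseq n M k) (k + 1)) := by
  obtain ⟨h0, -, -, h3, -⟩ := iterate_fM_urStr (N := Mseq n M k) (k := k + 1) rfl
  rw [Mseq, add_comm (urStr (Si _ _)), Function.iterate_add_apply,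
    iterate_fM_of_urStr_eq_zero (by omega) h0, Multiset.count_add,
    Multiset.count_replicate, if_pos rfl, h3, count_Mseq_of_lt n M _ (by omega)]

/-- If the segments `[k+1-s, k+1]` of `M` are dominated by the segments `[k-s, k]` of `M^(k)`, each
block of `S_{k+1}(M^(k))` cancels internally. -/
theorem siSurplus_Mseq_eq_sub {n : ℕ} {M : MS} {k t : ℕ}
    (h : ∀ s ≤ t, M.count (k + 1 - s, k + 1) ≤ (Mseq n M k).count (k + 1 - (s + 1), k)) :
    siSurplus (Mseq n M k) (k + 1) t =
      (Mseq n M k).count (k + 1 - (t + 1), k) - M.count (k + 1 - t, k + 1) := by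
  rw [siSurplus, surplus, excess_eq_zero, zero_add, opCount, clCount,
    count_Mseq_of_lt n M _ (Nat.lt_succ_self k), Nat.add_sub_cancel]
  intro s hs
  rw [opCount, clCount, count_Mseq_of_lt n M _ (Nat.lt_succ_self k)]
  exact h s hs.le

theorem sum_count_le_add_urStr_SiStar_Mseq {n : ℕ} (M : MS) (p : ℕ) {m : ℕ} (hm : m ≤ n) :
    ∑ t ∈ Finset.range m, M.count (p + 2, p + t + 2) ≤
      ∑ t ∈ Finset.range m, M.count (p + 1, p + t + 1) +
        urStr (SiStar n (Mseq n M p) (p + 1)) := by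
  refine le_of_eq_of_le (Finset.sum_congr rfl fun t _ => ?_)
    ((sum_count_le_add_urStr_SiStar n (Mseq n M p) (p + 1) hm).trans_eq ?_)
  · rw [count_Mseq_of_lt n M _ (by omega), show p + 1 + t + 1 = p + t + 2 by omega]
  · congr 1
    refine Finset.sum_congr rfl fun t _ => ?_
    rw [count_Mseq_of_lt n M _ (by omega), show p + 1 + t = p + t + 1 by omega]

/-- The multiplicity of `[p+1, p+d+1]` in `M^(p+d+1)`, in terms of the segments of `M` with lower
endpoint `p + 1` or `p + 2`. -/
theorem count_Mseq_add_sum (n : ℕ) (M : MS) (p d : ℕ) (hn : p + d + 1 ≤ n) :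
    (Mseq n M (p + d + 1)).count (p + 1, p + d + 1) +
        ∑ t ∈ Finset.range d, M.count (p + 2, p + t + 2) =
      ∑ t ∈ Finset.range (d + 1), M.count (p + 1, p + t + 1) +
        urStr (SiStar n (Mseq n M p) (p + 1)) := by
  induction d using Nat.strong_induction_on generalizing p with
  | _ d ih =>
    rcases d with _ | d
    · simpa using count_Mseq_succ_diag n M p
    · have hdom : ∀ s ≤ d, M.count (p + d + 1 + 1 - s, p + d + 1 + 1) ≤
          (Mseq n M (p + d + 1)).count (p + d + 1 + 1 - (s + 1), p + d + 1) := by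
        intro s hs
        obtain ⟨q, hq⟩ : ∃ q, p + d = q + s := ⟨p + d - s, by omega⟩
        have h1 := ih s (by omega) q (by omega)
        have h2 := sum_count_le_add_urStr_SiStar_Mseq (n := n) M q (m := s + 1) (by omega)
        rw [Finset.sum_range_succ] at h2
        rw [hq, show q + s + 1 + 1 - s = q + 2 by omega,
          show q + s + 1 + 1 - (s + 1) = q + 1 by omega, show q + s + 1 + 1 = q + s + 2 from rfl]
        omega
      have h1 := ih d (by omega) p (by omega)
      have h2 := siSurplus_Mseq_eq_sub hdom
      have h3 := count_Mseq_succ_right n M (p + d + 1) (t := d) (by omega)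
      have h4 := hdom d le_rfl
      rw [show p + d + 1 + 1 - (d + 1) = p + 1 by omega] at h2 h3 h4
      rw [show p + d + 1 + 1 - d = p + 2 by omega] at h2 h4
      rw [Finset.sum_range_succ, Finset.sum_range_succ _ (d + 1)]
      rw [show p + d + 1 + 1 = p + d + 2 from rfl] at h2 h3 h4
      simp only [← add_assoc, show p + d + 1 + 1 = p + d + 2 from rfl] at *
      omega

theorem count_le_count_Mseq {n : ℕ} (M : MS) {k s : ℕ} (hs : s < k) (hk : k ≤ n) :
    M.count (k + 1 - s, k + 1) ≤ (Mseq n M k).count (k + 1 - (s + 1), k) := by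
  obtain ⟨p, rfl⟩ : ∃ p, k = p + s + 1 := ⟨k - s - 1, by omega⟩
  have h1 := count_Mseq_add_sum n M p s hk
  have h2 := sum_count_le_add_urStr_SiStar_Mseq (n := n) M p (m := s + 1) (by omega)
  rw [Finset.sum_range_succ] at h2
  rw [show p + s + 1 + 1 - s = p + 2 by omega, show p + s + 1 + 1 - (s + 1) = p + 1 by omega,
    show p + s + 1 + 1 = p + s + 2 from rfl]
  omega

theorem stmt15 (n : ℕ) (M : MS) (hM : IsMS n M) (i k : ℕ)
    (h2 : 2 ≤ i) (hik : i ≤ k) (hkn : k ≤ n) :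
    (Mseq n M k).count (i - 1, k - 1) = M.count (i, k) := by
  obtain ⟨k, rfl⟩ : ∃ l, k = l + 1 := ⟨k - 1, by omega⟩
  obtain ⟨t, ht, rfl⟩ : ∃ t < k, i = k + 1 - t := ⟨k + 1 - i, by omega, by omega⟩
  have h1 := siSurplus_Mseq_eq_sub (n := n) (M := M) (k := k) (t := t)
    fun s hs => count_le_count_Mseq M (by omega) (by omega)
  have h3 := count_Mseq_succ_left n M k (t := t) (by omega)
  have h4 := count_le_count_Mseq (n := n) M ht (by omega)
  rw [Nat.sub_sub, Nat.add_sub_cancel]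
  omega
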